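/- Let G be a finite solvable group, χ a primitive irreducible complex character of G, and p a prime divisor of |G|. Then there exists g ∈ G such that the p-part χ(1)_p of χ(1) divides (|cl_G(g)|_p)³, the cube of the p-part of the conjugacy class size of g. -/

import Mathlib

open scoped Classical

/-- `χ : G → ℂ` is the character of some finite-dimensional complex representation of `G`. -/
def IsChar {G : Type*} [Group G] (χ : G → ℂ) : Prop :=
  ∃ (V : Type) (_ : AddCommGroup V) (_ : Module ℂ V) (_ : FiniteDimensional ℂ V)
    (ρ : Representation ℂ G V), ∀ g : G, χ g = LinearMap.trace ℂ V (ρ g)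

/-- `χ : G → ℂ` is the character of some irreducible finite-dimensional complex
representation of `G`. -/
def IsIrreducibleChar {G : Type*} [Group G] (χ : G → ℂ) : Prop :=
  ∃ (V : Type) (_ : AddCommGroup V) (_ : Module ℂ V) (_ : FiniteDimensional ℂ V)
    (ρ : Representation ℂ G V), Nontrivial V ∧
      (∀ U : Submodule ℂ V, (∀ g : G, ∀ v ∈ U, ρ g v ∈ U) → U = ⊥ ∨ U = ⊤) ∧
      ∀ g : G, χ g = LinearMap.trace ℂ V (ρ g)

/-- The class function of `G` induced from the function `ψ` on a subgroup `H`. -/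
noncomputable def inducedChar {G : Type*} [Group G] [Fintype G] (H : Subgroup G)
    (ψ : ↥H → ℂ) : G → ℂ :=
  fun g => (Nat.card H : ℂ)⁻¹ *
    ∑ x : G, if h : x⁻¹ * g * x ∈ H then ψ ⟨x⁻¹ * g * x, h⟩ else 0

/-- An irreducible character is primitive if it is not induced from a character of any
proper subgroup. -/
def IsPrimitiveChar {G : Type*} [Group G] [Fintype G] (χ : G → ℂ) : Prop :=
  IsIrreducibleChar χ ∧
    ∀ H : Subgroup G, H ≠ ⊤ → ∀ ψ : ↥H → ℂ, IsChar ψ → χ ≠ inducedChar H ψ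

/-- The size of the conjugacy class of `g` in `G`. -/
noncomputable def classSize {G : Type*} [Group G] (g : G) : ℕ :=
  Nat.card {x : G // IsConj g x}

/-- The `p`-part of a natural number `n`, i.e. the largest power of `p` dividing `n`. -/
def pPart (p n : ℕ) : ℕ := p ^ (n.factorization p)

theorem exists_normal_commutator_centralizes {G : Type*} [Group G] [Group.IsSolvable G]
    (S : Subgroup G) (hS : ¬ S ≤ Subgroup.center G) :
    ∃ N : Subgroup G, N.Normal ∧ ¬ N ≤ Subgroup.centralizer (S : Set G) ∧
      ∀ a ∈ N, ∀ b ∈ N, a * b * a⁻¹ * b⁻¹ ∈ Subgroup.centralizer (S : Set G) := by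
  have hex : ∃ k, derivedSeries G k ≤ Subgroup.centralizer (S : Set G) := by
    obtain ⟨k, hk⟩ := Group.IsSolvable.solvable (G := G)
    exact ⟨k, by simp [hk]⟩
  have h0 : Nat.find hex ≠ 0 := by
    intro h
    have h1 := Nat.find_spec hex
    rw [h, derivedSeries_zero] at h1
    refine hS fun s hs => Subgroup.mem_center_iff.2 fun g => ?_
    exact (Subgroup.mem_centralizer_iff.1 (h1 (Subgroup.mem_top g)) s hs).symm
  obtain ⟨k, hk⟩ := Nat.exists_eq_succ_of_ne_zero h0
  refine ⟨derivedSeries G k, inferInstance, Nat.find_min hex (by omega), fun a ha b hb => ?_⟩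
  have h1 := Nat.find_spec hex
  rw [hk, Nat.succ_eq_add_one, derivedSeries_succ] at h1
  exact h1 (Subgroup.commutator_mem_commutator ha hb)

theorem card_mul_relIndex_of_le {G : Type*} [Group G] {H K : Subgroup G} (h : H ≤ K) :
    Nat.card H * H.relIndex K = Nat.card K := by
  rw [← Subgroup.relIndex_bot_left, Subgroup.relIndex_mul_relIndex _ _ _ bot_le h,
    Subgroup.relIndex_bot_left]

theorem card_sup_mul_card_inf {G : Type*} [Group G] (N C : Subgroup G) [N.Normal] :
    Nat.card ↥(N ⊔ C) * Nat.card ↥(N ⊓ C) = Nat.card N * Nat.card C := by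
  have h1 : Nat.card N * N.relIndex C = Nat.card ↥(N ⊔ C) := by
    rw [← Subgroup.relIndex_sup_left]; exact card_mul_relIndex_of_le le_sup_left
  have h2 : Nat.card ↥(N ⊓ C) * N.relIndex C = Nat.card C := by
    rw [← Subgroup.inf_relIndex_right]; exact card_mul_relIndex_of_le inf_le_right
  rw [← h1, ← h2]; ring

theorem normal_subgroupOf_of_commute {G : Type*} [Group G] {S : Subgroup G}
    (hab : ∀ x ∈ S, ∀ y ∈ S, x * y = y * x) (A : Subgroup G) : (A.subgroupOf S).Normal :=
  ⟨fun n hn g => by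
    rw [Subgroup.mem_subgroupOf] at hn ⊢
    simpa [hab g g.2 n n.2] using hn⟩

theorem card_sup_mul_card_inf_of_commute {G : Type*} [Group G] {S A B : Subgroup G}
    (hab : ∀ x ∈ S, ∀ y ∈ S, x * y = y * x) (hA : A ≤ S) (hB : B ≤ S) :
    Nat.card ↥(A ⊔ B) * Nat.card ↥(A ⊓ B) = Nat.card A * Nat.card B := by
  have hN := normal_subgroupOf_of_commute hab A
  have h := card_sup_mul_card_inf (A.subgroupOf S) (B.subgroupOf S)
  have hc : ∀ T : Subgroup G, T ≤ S → Nat.card (T.subgroupOf S) = Nat.card T := fun T hT =>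
    Nat.card_congr (Subgroup.subgroupOfEquivOfLe hT).toEquiv
  rwa [← Subgroup.subgroupOf_sup hA hB, hc A hA, hc B hB, hc _ (sup_le hA hB),
    ← Subgroup.comap_subtype, ← Subgroup.comap_subtype, ← Subgroup.comap_inf,
    Subgroup.comap_subtype, hc _ (inf_le_left.trans hA)] at h

theorem relIndex_mul_index_centralizer_dvd {G : Type*} [Group G] [Finite G] (N : Subgroup G)
    [N.Normal] (g : G) :
    (Subgroup.centralizer {g}).relIndex N * (Subgroup.centralizer {(g : G ⧸ N)}).index ∣
      (Subgroup.centralizer {g}).index := by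
  set C := Subgroup.centralizer {g}
  set L := (Subgroup.centralizer {(g : G ⧸ N)}).comap (QuotientGroup.mk' N) with hL
  have h1 : L.index = (Subgroup.centralizer {(g : G ⧸ N)}).index :=
    Subgroup.index_comap_of_surjective _ (QuotientGroup.mk'_surjective N)
  have hNC : N ⊔ C ≤ L := by
    refine sup_le (fun n hn => ?_) (fun c hc => ?_)
    · rw [hL, Subgroup.mem_comap, Subgroup.mem_centralizer_singleton_iff]
      simp [(QuotientGroup.eq_one_iff n).2 hn]
    · rw [hL, Subgroup.mem_comap, Subgroup.mem_centralizer_singleton_iff]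
      have := Subgroup.mem_centralizer_singleton_iff.1 hc
      simp only [QuotientGroup.mk'_apply, ← QuotientGroup.mk_mul, this]
  have h2 : C.relIndex N = C.relIndex (N ⊔ C) := by
    have e1 := card_sup_mul_card_inf N C
    have e2 : Nat.card ↥(N ⊓ C) * C.relIndex N = Nat.card N := by
      rw [← Subgroup.inf_relIndex_left]; exact card_mul_relIndex_of_le inf_le_left
    have e3 : Nat.card C * C.relIndex (N ⊔ C) = Nat.card ↥(N ⊔ C) :=
      card_mul_relIndex_of_le le_sup_right
    rw [← e2, ← e3] at e1
    refine (Nat.eq_of_mul_eq_mul_left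
      (Nat.mul_pos (Nat.card_pos (α := C)) (Nat.card_pos (α := ↥(N ⊓ C)))) ?_)
    linarith
  rw [h2, ← h1]
  refine dvd_trans (mul_dvd_mul_left _ (Subgroup.index_dvd_of_le hNC)) ?_
  rw [Subgroup.relIndex_mul_index le_sup_right]

theorem card_mul_card_dvd {G : Type*} [Group G] {S A B C : Subgroup G}
    (hab : ∀ x ∈ S, ∀ y ∈ S, x * y = y * x) (hA : A ≤ S) (hB : B ≤ S) (hC : A ⊓ B ≤ C) :
    Nat.card A * Nat.card B ∣ Nat.card S * Nat.card C := by
  rw [← card_sup_mul_card_inf_of_commute hab hA hB]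
  exact mul_dvd_mul (Subgroup.card_dvd_of_le (sup_le hA hB)) (Subgroup.card_dvd_of_le hC)

/-- `U` is a minimal nontrivial `N`-invariant subgroup of `S`. -/
structure IsMinimalInvariant {G : Type*} [Group G] (S N U : Subgroup G) : Prop where
  le : U ≤ S
  invariant : ∀ n ∈ N, ∀ u ∈ U, n * u * n⁻¹ ∈ U
  ne_bot : U ≠ ⊥
  minimal : ∀ T : Subgroup G, (∀ n ∈ N, ∀ t ∈ T, n * t * n⁻¹ ∈ T) → T ≤ U → T = ⊥ ∨ T = U

theorem IsMinimalInvariant.conj {G : Type*} [Group G] {S N U : Subgroup G} [S.Normal] [N.Normal]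
    (h : IsMinimalInvariant S N U) (g : G) :
    IsMinimalInvariant S N (U.comap (MulAut.conj g⁻¹).toMonoidHom) := by
  have hmem : ∀ (a : G) (T : Subgroup G) (x : G),
      x ∈ T.comap (MulAut.conj a).toMonoidHom ↔ a * x * a⁻¹ ∈ T := fun a T x => by simp
  have hinv : ∀ (a : G) (T : Subgroup G), (∀ n ∈ N, ∀ t ∈ T, n * t * n⁻¹ ∈ T) →
      ∀ n ∈ N, ∀ t ∈ T.comap (MulAut.conj a).toMonoidHom,
        n * t * n⁻¹ ∈ T.comap (MulAut.conj a).toMonoidHom := by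
    intro a T hT n hn t ht
    rw [hmem] at ht ⊢
    convert hT (a * n * a⁻¹) (‹N.Normal›.conj_mem n hn a) _ ht using 1
    group
  have hcancel : ∀ T : Subgroup G,
      (T.comap (MulAut.conj g).toMonoidHom).comap (MulAut.conj g⁻¹).toMonoidHom = T := by
    intro T
    ext x
    rw [hmem, hmem]
    simp [mul_assoc]
  refine ⟨fun x hx => ?_, hinv _ _ h.invariant, fun hb => h.ne_bot ?_, fun T hT hTU => ?_⟩
  · rw [hmem] at hx
    have := ‹S.Normal›.conj_mem _ (h.le hx) g
    simpa [mul_assoc] using this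
  · rw [Subgroup.eq_bot_iff_forall] at hb ⊢
    intro x hx
    have := hb (g * x * g⁻¹) (by rw [hmem]; simpa [mul_assoc] using hx)
    simpa using this
  · have hle : T.comap (MulAut.conj g).toMonoidHom ≤ U := fun x hx => by
      rw [hmem] at hx
      have := hTU hx
      rw [hmem] at this
      simpa [mul_assoc] using this
    rcases h.minimal _ (hinv _ _ hT) hle with h1 | h1
    · left
      rw [← hcancel T, h1]
      exact (MonoidHom.ker_eq_bot_iff _).2 (MulAut.conj g⁻¹).injective
    · right
      rw [← hcancel T, h1]

theorem IsMinimalInvariant.sum_le {G : Type*} [Group G] [Fintype G] (p : ℕ)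
    {S N U : Subgroup G} [S.Normal] [N.Normal]
    (hmin : ∀ T : Subgroup G, T.Normal → T ≤ S → T = ⊥ ∨ T = S)
    (hN : ¬ N ≤ Subgroup.centralizer (S : Set G))
    (hcomm : ∀ a ∈ N, ∀ b ∈ N, a * b * a⁻¹ * b⁻¹ ∈ Subgroup.centralizer (S : Set G))
    (h : IsMinimalInvariant S N U) :
    2 * ∑ n : N, (Nat.card ↥(U ⊓ Subgroup.centralizer {(n : G)})).factorization p ≤
      Nat.card N * (Nat.card U).factorization p := by
  set K := (Subgroup.centralizer (U : Set G)).subgroupOf N with hK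
  have hKtop : K ≠ ⊤ := by
    intro hKt
    rw [hK, Subgroup.subgroupOf_eq_top] at hKt
    have hle : U ≤ S ⊓ Subgroup.centralizer (N : Set G) :=
      le_inf h.le (Subgroup.le_centralizer_iff.1 hKt)
    rcases hmin (S ⊓ Subgroup.centralizer (N : Set G)) inferInstance inf_le_left with h1 | h1
    · exact h.ne_bot (le_bot_iff.1 (h1 ▸ hle))
    · exact hN (Subgroup.le_centralizer_iff.1 (inf_eq_left.1 h1))
  have hval : ∀ n : N, (Nat.card ↥(U ⊓ Subgroup.centralizer {(n : G)})).factorization p =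
      if n ∈ K then (Nat.card U).factorization p else 0 := by
    intro n
    have hdich := h.minimal (U ⊓ Subgroup.centralizer {(n : G)}) (by
      rintro m hm x ⟨hx, hxn⟩
      refine ⟨h.invariant m hm x hx, ?_⟩
      change x ∈ Subgroup.centralizer _ at hxn
      change _ ∈ Subgroup.centralizer _
      rw [Subgroup.mem_centralizer_singleton_iff] at hxn ⊢
      have hc := Subgroup.mem_centralizer_iff.1 (hcomm (n : G)⁻¹ (N.inv_mem n.2) m⁻¹
        (N.inv_mem hm)) x (h.le hx)
      have e : x * ((n : G)⁻¹ * m⁻¹ * n * m) = (n : G)⁻¹ * m⁻¹ * n * m * x := by simpa using hc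
      calc m * x * m⁻¹ * n = m * (x * n) * ((n : G)⁻¹ * m⁻¹ * n * m) * m⁻¹ := by group
        _ = m * n * (x * ((n : G)⁻¹ * m⁻¹ * n * m)) * m⁻¹ := by rw [hxn]; group
        _ = n * (m * x * m⁻¹) := by rw [e]; group) inf_le_left
    have hmemK : n ∈ K ↔ U ≤ Subgroup.centralizer {(n : G)} := by
      rw [hK, Subgroup.mem_subgroupOf, Subgroup.mem_centralizer_iff]
      exact forall₂_congr fun u _ => Subgroup.mem_centralizer_singleton_iff.symm
    split_ifs with hnK
    · rw [inf_eq_left.2 (hmemK.1 hnK)]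
    · rcases hdich with h1 | h1
      · simp [h1]
      · exact absurd (hmemK.2 (inf_eq_left.1 h1)) hnK
  simp only [hval]
  rw [← Finset.sum_filter, Finset.sum_const, smul_eq_mul, ← mul_assoc]
  refine Nat.mul_le_mul_right _ ?_
  have h1 : (Finset.univ.filter (· ∈ K)).card = Nat.card K := by
    rw [Nat.card_eq_fintype_card, Fintype.card_subtype]
  rw [h1, ← K.card_mul_index, mul_comm]
  exact Nat.mul_le_mul_left _ (Subgroup.one_lt_index_of_ne_top hKtop)

/-- Elements of a normal subgroup, acting by conjugation with abelian image on an abelian minimal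
normal subgroup `S`, fix on average at most half of `S`. -/
theorem sum_factorization_card_fixed_le {G : Type*} [Group G] [Fintype G] (p : ℕ)
    (S N : Subgroup G) [S.Normal] [N.Normal] (hab : ∀ x ∈ S, ∀ y ∈ S, x * y = y * x)
    (hmin : ∀ T : Subgroup G, T.Normal → T ≤ S → T = ⊥ ∨ T = S)
    (hN : ¬ N ≤ Subgroup.centralizer (S : Set G))
    (hcomm : ∀ a ∈ N, ∀ b ∈ N, a * b * a⁻¹ * b⁻¹ ∈ Subgroup.centralizer (S : Set G)) :
    2 * ∑ n : N, (Nat.card ↥(S ⊓ Subgroup.centralizer {(n : G)})).factorization p ≤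
      Nat.card N * (Nat.card S).factorization p := by
  have hSbot : S ≠ ⊥ := by
    rintro rfl
    exact hN fun n _ => Subgroup.mem_centralizer_iff.2 fun x hx => by
      simp [Subgroup.mem_bot.1 hx]
  obtain ⟨U₀, hU₀⟩ : ∃ U₀, IsMinimalInvariant S N U₀ := by
    obtain ⟨U, hU⟩ := (Set.toFinite {U : Subgroup G | U ≤ S ∧
      (∀ n ∈ N, ∀ u ∈ U, n * u * n⁻¹ ∈ U) ∧ U ≠ ⊥}).exists_minimal
      ⟨S, le_rfl, fun n _ u hu => ‹S.Normal›.conj_mem u hu n, hSbot⟩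
    refine ⟨U, hU.prop.1, hU.prop.2.1, hU.prop.2.2, fun T hT hTU => ?_⟩
    refine or_iff_not_imp_left.2 fun hTb => le_antisymm hTU ?_
    exact hU.le_of_le ⟨hTU.trans hU.prop.1, hT, hTb⟩ hTU
  obtain ⟨W, hW⟩ := (Set.toFinite {W : Subgroup G | W ≤ S ∧
      (∀ n ∈ N, ∀ u ∈ W, n * u * n⁻¹ ∈ W) ∧
      2 * ∑ n : N, (Nat.card ↥(W ⊓ Subgroup.centralizer {(n : G)})).factorization p ≤
        Nat.card N * (Nat.card W).factorization p}).exists_maximal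
      ⟨⊥, bot_le, fun n _ u hu => by simp [Subgroup.mem_bot.1 hu], by simp⟩
  obtain ⟨hWS, hWinv, hWle⟩ := hW.prop
  by_cases hconj : ∀ g, ∀ u ∈ U₀, g * u * g⁻¹ ∈ W
  · have h1 : Subgroup.normalClosure (U₀ : Set G) = S := by
      rcases hmin _ Subgroup.normalClosure_normal (Subgroup.normalClosure_le_normal hU₀.le)
        with h | h
      · exact absurd (le_bot_iff.1 (h ▸ Subgroup.le_normalClosure)) hU₀.ne_bot
      · exact h
    have h2 : S ≤ W := by
      rw [← h1, Subgroup.normalClosure, Subgroup.closure_le]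
      intro x hx
      obtain ⟨u, hu, hux⟩ := Group.mem_conjugatesOfSet_iff.1 hx
      obtain ⟨g, rfl⟩ := isConj_iff.1 hux
      exact hconj g u hu
    rwa [le_antisymm hWS h2] at hWle
  · exfalso
    push Not at hconj
    obtain ⟨g, u, hu, hguW⟩ := hconj
    set U := U₀.comap (MulAut.conj g⁻¹).toMonoidHom with hUdef
    have hU : IsMinimalInvariant S N U := hU₀.conj g
    have hguU : g * u * g⁻¹ ∈ U := by simpa [hUdef, mul_assoc] using hu
    have hinf : W ⊓ U = ⊥ := by
      refine (hU.minimal (W ⊓ U) (fun n hn t ht => ⟨hWinv n hn t ht.1, hU.invariant n hn t ht.2⟩)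
        inf_le_right).resolve_right fun h => hguW ?_
      rw [← h] at hguU
      exact hguU.1
    have hcard : ∀ A B : Subgroup G, A ≤ W → B ≤ U →
        (Nat.card ↥(A ⊔ B)).factorization p =
          (Nat.card A).factorization p + (Nat.card B).factorization p := by
      intro A B hA hB
      have h := card_sup_mul_card_inf_of_commute hab (hA.trans hWS) (hB.trans hU.le)
      rw [le_bot_iff.1 ((inf_le_inf hA hB).trans hinf.le), Subgroup.card_bot, mul_one] at h
      rw [h, Nat.factorization_mul Nat.card_pos.ne' Nat.card_pos.ne']
      rfl
    have hfix : ∀ n : N, (W ⊔ U) ⊓ Subgroup.centralizer {(n : G)} =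
        (W ⊓ Subgroup.centralizer {(n : G)}) ⊔ (U ⊓ Subgroup.centralizer {(n : G)}) := by
      intro n
      refine le_antisymm ?_ (sup_le (inf_le_inf_right _ le_sup_left)
        (inf_le_inf_right _ le_sup_right))
      rintro x ⟨hx, hxn⟩
      change x ∈ Subgroup.centralizer _ at hxn
      change x ∈ W ⊔ U at hx
      rw [Subgroup.mem_centralizer_singleton_iff] at hxn
      have hUn := normal_subgroupOf_of_commute hab U
      obtain ⟨w, hw, v, hv, rfl⟩ : ∃ w ∈ W, ∃ v ∈ U, w * v = x := by
        have hxS : x ∈ S := sup_le hWS hU.le hx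
        have h : (⟨x, hxS⟩ : S) ∈ W.subgroupOf S ⊔ U.subgroupOf S := by
          rw [← Subgroup.subgroupOf_sup hWS hU.le]
          exact hx
        obtain ⟨w, hw, v, hv, h⟩ := Subgroup.mem_sup_of_normal_right.1 h
        exact ⟨w, hw, v, hv, congrArg Subtype.val h⟩
      have hw' := hWinv n n.2 w hw
      have hv' := hU.invariant n n.2 v hv
      have key : w⁻¹ * (n * w * (n : G)⁻¹) = v * (n * v * (n : G)⁻¹)⁻¹ := by
        have : (n * w * (n : G)⁻¹) * (n * v * (n : G)⁻¹) = w * v := by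
          rw [eq_mul_inv_of_mul_eq hxn]; group
        rw [inv_mul_eq_iff_eq_mul, ← mul_assoc, eq_mul_inv_iff_mul_eq, this]
      have h1 : w⁻¹ * (n * w * (n : G)⁻¹) = 1 := by
        have : w⁻¹ * (n * w * (n : G)⁻¹) ∈ W ⊓ U :=
          ⟨W.mul_mem (W.inv_mem hw) hw', key ▸ U.mul_mem hv (U.inv_mem hv')⟩
        rwa [hinf] at this
      have h2 : v * (n * v * (n : G)⁻¹)⁻¹ = 1 := key ▸ h1
      refine Subgroup.mul_mem_sup ⟨hw, ?_⟩ ⟨hv, ?_⟩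
      · refine Subgroup.mem_centralizer_singleton_iff.2 ?_
        exact mul_inv_eq_iff_eq_mul.1 (inv_mul_eq_one.1 h1).symm |>.symm
      · refine Subgroup.mem_centralizer_singleton_iff.2 ?_
        exact mul_inv_eq_iff_eq_mul.1 (mul_inv_eq_one.1 h2).symm |>.symm
    have hmem : W ⊔ U ∈ {W : Subgroup G | W ≤ S ∧
      (∀ n ∈ N, ∀ u ∈ W, n * u * n⁻¹ ∈ W) ∧
      2 * ∑ n : N, (Nat.card ↥(W ⊓ Subgroup.centralizer {(n : G)})).factorization p ≤
        Nat.card N * (Nat.card W).factorization p} := by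
      refine ⟨sup_le hWS hU.le, fun n hn x hx => ?_, ?_⟩
      · have : W ⊔ U ≤ (W ⊔ U).comap (MulAut.conj n).toMonoidHom := by
          refine sup_le (fun w hw => ?_) (fun w hw => ?_)
          · have := hWinv n hn w hw
            simpa using Subgroup.mem_sup_left this
          · have := hU.invariant n hn w hw
            simpa using Subgroup.mem_sup_right this
        simpa using this hx
      · have hUle := hU.sum_le p hmin hN hcomm
        rw [hcard W U le_rfl le_rfl]
        simp only [hfix]
        rw [Finset.sum_congr rfl fun n _ => hcard _ _ inf_le_left inf_le_left,
          Finset.sum_add_distrib]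
        linarith
    exact hguW (hW.le_of_ge hmem le_sup_left (Subgroup.mem_sup_right hguU))

theorem sum_factorization_card_inf_centralizer_le {G : Type*} [Group G] [Fintype G]
    [Group.IsSolvable G] (p : ℕ)
    (S : Subgroup G) [S.Normal] (hab : ∀ x ∈ S, ∀ y ∈ S, x * y = y * x)
    (hmin : ∀ T : Subgroup G, T.Normal → T ≤ S → T = ⊥ ∨ T = S)
    (hS : ¬ S ≤ Subgroup.center G) :
    4 * ∑ g : G, (Nat.card ↥(S ⊓ Subgroup.centralizer {g})).factorization p ≤
      3 * Nat.card G * (Nat.card S).factorization p := by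
  obtain ⟨N, hNn, hN, hcomm⟩ := exists_normal_commutator_centralizes S hS
  have hhalf := sum_factorization_card_fixed_le p S N hab hmin hN hcomm
  set f : G → ℕ := fun g => (Nat.card ↥(S ⊓ Subgroup.centralizer {g})).factorization p with hf
  have hpair : ∀ (g : G) (n : N), f (g * n) + f g ≤ (Nat.card S).factorization p + f n := by
    intro g n
    have h := card_mul_card_dvd hab (S := S) (A := S ⊓ Subgroup.centralizer {g * (n : G)})
      (B := S ⊓ Subgroup.centralizer {g}) (C := S ⊓ Subgroup.centralizer {(n : G)})
      inf_le_left inf_le_left (by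
        rintro x ⟨⟨hx, h1⟩, -, h2⟩
        refine ⟨hx, ?_⟩
        change x ∈ Subgroup.centralizer _ at h1 h2
        change x ∈ Subgroup.centralizer _
        rw [Subgroup.mem_centralizer_singleton_iff] at h1 h2 ⊢
        apply mul_left_cancel (a := g)
        rw [← mul_assoc, ← h2, mul_assoc, h1, mul_assoc])
    have h' := (Nat.factorization_le_iff_dvd (mul_ne_zero Nat.card_pos.ne' Nat.card_pos.ne')
      (mul_ne_zero Nat.card_pos.ne' Nat.card_pos.ne')).2 h p
    rwa [Nat.factorization_mul Nat.card_pos.ne' Nat.card_pos.ne',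
      Nat.factorization_mul Nat.card_pos.ne' Nat.card_pos.ne'] at h'
  have hsum := Finset.sum_le_sum fun (g : G) (_ : g ∈ Finset.univ) =>
    Finset.sum_le_sum fun (n : N) (_ : n ∈ Finset.univ) => hpair g n
  have hshift : ∑ g : G, ∑ n : N, f (g * n) = Nat.card N * ∑ g : G, f g := by
    rw [Finset.sum_comm, Nat.card_eq_fintype_card, ← Finset.card_univ, ← smul_eq_mul,
      ← Finset.sum_const]
    exact Finset.sum_congr rfl fun n _ => Equiv.sum_comp (Equiv.mulRight (n : G)) f
  simp only [Finset.sum_add_distrib, hshift, Finset.sum_const, Finset.card_univ, smul_eq_mul,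
    ← Finset.mul_sum, ← Nat.card_eq_fintype_card] at hsum
  have hNpos : 0 < Nat.card N := Nat.card_pos
  refine Nat.le_of_mul_le_mul_left ?_ hNpos
  have hm := Nat.mul_le_mul_left (Nat.card G) hhalf
  change Nat.card G * (2 * ∑ n : N, f n) ≤ _ at hm
  nlinarith

section Algebra

variable {G : Type*} [Group G] {E : Type} [Ring E] [Algebra ℂ E]

/-- The action of `G` on the algebra `E` has no system of imprimitivity: an idempotent whose
translates are pairwise orthogonal is trivial. -/
def IsPrimitiveAction (φ : G →* (E →ₐ[ℂ] E)) : Prop :=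
  ∀ e : E, e * e = e → (∀ g, φ g e = e ∨ e * φ g e = 0) → e = 0 ∨ e = 1

/-- The subalgebra of `S`-fixed elements. -/
def fixedSubalgebra (φ : G →* (E →ₐ[ℂ] E)) (S : Subgroup G) : Subalgebra ℂ E where
  carrier := {x | ∀ s ∈ S, φ s x = x}
  mul_mem' hx hy s hs := by rw [map_mul, hx s hs, hy s hs]
  add_mem' hx hy s hs := by rw [map_add, hx s hs, hy s hs]
  algebraMap_mem' c s _ := (φ s).commutes c

theorem mem_fixedSubalgebra {φ : G →* (E →ₐ[ℂ] E)} {S : Subgroup G} {x : E} :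
    x ∈ fixedSubalgebra φ S ↔ ∀ s ∈ S, φ s x = x := Iff.rfl

theorem map_inv_apply_self (φ : G →* (E →ₐ[ℂ] E)) (g : G) (x : E) : φ g⁻¹ (φ g x) = x := by
  rw [← AlgHom.mul_apply, ← map_mul, inv_mul_cancel, map_one, AlgHom.one_apply]

theorem map_apply_inv_self (φ : G →* (E →ₐ[ℂ] E)) (g : G) (x : E) : φ g (φ g⁻¹ x) = x := by
  rw [← AlgHom.mul_apply, ← map_mul, mul_inv_cancel, map_one, AlgHom.one_apply]

theorem map_mem_fixedSubalgebra (φ : G →* (E →ₐ[ℂ] E)) (S : Subgroup G) [S.Normal] (g : G)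
    {x : E} (hx : x ∈ fixedSubalgebra φ S) : φ g x ∈ fixedSubalgebra φ S := by
  intro s hs
  have h := hx _ (‹S.Normal›.conj_mem s hs g⁻¹)
  conv_rhs => rw [← h]
  rw [← AlgHom.mul_apply, ← AlgHom.mul_apply, ← map_mul, ← map_mul]
  congr 2
  group

theorem idempotent_eq_zero_or_one [FiniteDimensional ℂ E] {φ : G →* (E →ₐ[ℂ] E)}
    (hφ : IsPrimitiveAction φ) (B : Subalgebra ℂ E) (hB : ∀ x ∈ B, ∀ y ∈ B, x * y = y * x)
    (hBφ : ∀ g, ∀ x ∈ B, φ g x ∈ B) {e : E} (he : e ∈ B) (hee : e * e = e) :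
    e = 0 ∨ e = 1 := by
  refine or_iff_not_imp_left.2 fun he0 => ?_
  let r : E → Submodule ℂ E := fun x => LinearMap.range (LinearMap.mulLeft ℂ x)
  have hr_mul : ∀ x y, r (x * y) ≤ r x := by
    rintro x y _ ⟨z, rfl⟩
    exact ⟨y * z, by simp⟩
  have hr_self : ∀ x, x ∈ r x := fun x => ⟨1, by simp⟩
  have hr_map : ∀ g x, Module.finrank ℂ (r (φ g x)) ≤ Module.finrank ℂ (r x) := by
    intro g x
    have : r (φ g x) = (r x).map (φ g).toLinearMap := by
      ext y
      constructor
      · rintro ⟨z, rfl⟩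
        exact ⟨x * φ g⁻¹ z, ⟨φ g⁻¹ z, rfl⟩, by simp [map_apply_inv_self]⟩
      · rintro ⟨_, ⟨z, rfl⟩, rfl⟩
        exact ⟨φ g z, by simp⟩
    rw [this]
    exact Submodule.finrank_map_le _ _
  let P : Set E := {f | f ∈ B ∧ f * f = f ∧ f ≠ 0 ∧ f * e = f}
  obtain ⟨f, ⟨hfB, hff, hf0, hfe⟩, hmin⟩ := exists_minimalFor_of_wellFoundedLT (· ∈ P)
    (fun x => Module.finrank ℂ (r x)) ⟨e, he, hee, he0, hee⟩
  have h1 : f = 0 ∨ f = 1 := by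
    refine hφ f hff fun g => or_iff_not_imp_right.2 fun hne => ?_
    set k := φ g f with hk
    have hkB : k ∈ B := hBφ g f hfB
    have hkk : k * k = k := by rw [hk, ← map_mul, hff]
    have hcomm : f * k = k * f := hB _ hfB _ hkB
    have hP : f * k ∈ P := by
      refine ⟨B.mul_mem hfB hkB, ?_, hne, ?_⟩
      · calc f * k * (f * k) = f * (k * f) * k := by noncomm_ring
          _ = (f * f) * (k * k) := by rw [← hcomm]; noncomm_ring
          _ = f * k := by rw [hff, hkk]
      · rw [hcomm, mul_assoc, hfe]
    have hle : Module.finrank ℂ (r f) ≤ Module.finrank ℂ (r (f * k)) := by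
      by_contra hlt
      exact hlt (hmin hP (not_le.1 hlt).le)
    have e1 : r (f * k) = r f := Submodule.eq_of_le_of_finrank_le (hr_mul f k) hle
    have e2 : r (f * k) = r k := Submodule.eq_of_le_of_finrank_le
      (hcomm ▸ hr_mul k f) ((hr_map g f).trans hle)
    obtain ⟨y, hy⟩ : k ∈ r f := e1 ▸ e2 ▸ hr_self k
    obtain ⟨z, hz⟩ : f ∈ r k := e2 ▸ e1 ▸ hr_self f
    rw [LinearMap.mulLeft_apply] at hy hz
    calc k = f * k := by rw [← hy, ← mul_assoc, hff]
      _ = k * f := hcomm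
      _ = f := by rw [← hz, ← mul_assoc, hkk]
  rw [h1.resolve_left hf0, one_mul] at hfe
  exact hfe

theorem exists_eq_algebraMap_of_pow_eq [FiniteDimensional ℂ E] [Nontrivial E]
    {φ : G →* (E →ₐ[ℂ] E)}
    (hφ : IsPrimitiveAction φ) (B : Subalgebra ℂ E) (hB : ∀ x ∈ B, ∀ y ∈ B, x * y = y * x)
    (hBφ : ∀ g, ∀ x ∈ B, φ g x ∈ B) {u : E} (hu : u ∈ B) {m : ℕ} (hm : m ≠ 0) {c : ℂ}
    (hc : c ≠ 0) (huc : u ^ m = algebraMap ℂ E c) : ∃ w : ℂ, u = algebraMap ℂ E w := by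
  obtain ⟨w, hw⟩ := Module.End.exists_eigenvalue (LinearMap.mulLeft ℂ u)
  obtain ⟨x, hx⟩ := hw.exists_hasEigenvector
  have hx1 : u * x = w • x := hx.apply_eq_smul
  have hpow : ∀ i, u ^ i * x = w ^ i • x := by
    intro i
    induction i with
    | zero => simp
    | succ i ih => rw [pow_succ, mul_assoc, hx1, mul_smul_comm, ih, smul_smul, pow_succ, mul_comm]
  have hwm : w ^ m = c := by
    have := hpow m
    rw [huc, ← Algebra.smul_def] at this
    exact (smul_left_injective ℂ hx.2 this).symm
  have hw0 : w ≠ 0 := fun h => hc (by rw [← hwm, h, zero_pow hm])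
  set W := algebraMap ℂ E w
  set q : E := ∑ i ∈ Finset.range m, u ^ i * W ^ (m - 1 - i) with hq
  have hcomm : Commute u W := (Algebra.commutes w u).symm
  have hqu : q * (u - W) = 0 := by
    rw [hq, hcomm.geom_sum₂_mul, huc, ← map_pow, hwm, sub_self]
  have hqB : q ∈ B := B.sum_mem fun i _ =>
    B.mul_mem (B.pow_mem hu i) (B.pow_mem (B.algebraMap_mem w) _)
  have huq : u * q = w • q := by
    rw [hB _ hu _ hqB, Algebra.smul_def, Algebra.commutes, ← sub_eq_zero, ← mul_sub, hqu]
  set d : ℂ := m * w ^ (m - 1) with hd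
  have hd0 : d ≠ 0 := mul_ne_zero (by exact_mod_cast hm) (pow_ne_zero _ hw0)
  have hgen : ∀ y : E, u * y = w • y → q * y = d • y := by
    intro y hy
    have hpow : ∀ i, u ^ i * y = w ^ i • y := by
      intro i
      induction i with
      | zero => simp
      | succ i ih => rw [pow_succ, mul_assoc, hy, mul_smul_comm, ih, smul_smul, pow_succ, mul_comm]
    rw [hq, Finset.sum_mul, hd, ← nsmul_eq_mul, smul_assoc, ← Finset.card_range m,
      ← Finset.sum_const, Finset.card_range]
    refine Finset.sum_congr rfl fun i hi => ?_
    rw [← map_pow, ← Algebra.commutes, ← Algebra.smul_def, smul_mul_assoc, hpow, smul_smul,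
      ← pow_add]
    congr 2
    have := Finset.mem_range.1 hi
    omega
  rcases idempotent_eq_zero_or_one hφ B hB hBφ (e := d⁻¹ • q) (B.smul_mem hqB _)
    (by rw [smul_mul_smul_comm, hgen q huq, smul_smul]; congr 1; field_simp) with h | h
  · exfalso
    have h1 : d⁻¹ • (q * x) = 0 := by rw [← smul_mul_assoc, h, zero_mul]
    rw [hgen x hx1, smul_smul, inv_mul_cancel₀ hd0, one_smul] at h1
    exact hx.2 h1
  · refine ⟨w, ?_⟩
    have h1 : u * (d⁻¹ • q) = w • (d⁻¹ • q) := by rw [mul_smul_comm, huq, smul_comm]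
    rw [h, mul_one] at h1
    rw [h1, Algebra.algebraMap_eq_smul_one]

theorem exists_unit_conj [FiniteDimensional ℂ E] [IsSimpleRing E] (φ : G →* (E →ₐ[ℂ] E)) (g : G) :
    ∃ u : Eˣ, ∀ x, φ g x = u * x * ↑u⁻¹ := by
  obtain ⟨n, _, ⟨f⟩⟩ := IsSimpleRing.exists_algEquiv_matrix_of_isAlgClosed ℂ E
  let a : E ≃ₐ[ℂ] E := AlgEquiv.ofAlgHom (φ g) (φ g⁻¹)
    (AlgHom.ext (map_apply_inv_self φ g)) (AlgHom.ext (map_inv_apply_self φ g))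
  let F : E ≃ₐ[ℂ] Module.End ℂ (Fin n → ℂ) := f.trans Matrix.toLinAlgEquiv'
  obtain ⟨T, hT⟩ := ((F.symm.trans a).trans F).eq_linearEquivConjAlgEquiv
  let u : (Module.End ℂ (Fin n → ℂ))ˣ := LinearMap.GeneralLinearGroup.ofLinearEquiv T
  refine ⟨Units.map F.symm.toRingEquiv.toMonoidHom u, fun x => ?_⟩
  have h1 : F (φ g x) = u * F x * ↑u⁻¹ := by
    have := DFunLike.congr_fun hT (F x)
    have h2 : ((F.symm.trans a).trans F) (F x) = F (φ g x) := by simp [a]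
    rw [← h2, this]
    ext1
    rfl
  have h3 := congrArg F.symm h1
  simpa using h3

theorem exists_eq_algebraMap_of_commute [FiniteDimensional ℂ E] [IsSimpleRing E] {x : E}
    (hx : ∀ y, x * y = y * x) : ∃ c : ℂ, x = algebraMap ℂ E c := by
  obtain ⟨n, _, ⟨f⟩⟩ := IsSimpleRing.exists_algEquiv_matrix_of_isAlgClosed ℂ E
  have : Algebra.IsCentral ℂ E := Algebra.IsCentral.of_algEquiv ℂ _ _ f.symm
  have h := this.out (Subalgebra.mem_center_iff.2 fun y => (hx y).symm)
  obtain ⟨c, hc⟩ := Algebra.mem_bot.1 h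
  exact ⟨c, hc.symm⟩

end Algebra

section Twist

variable {G : Type*} [Group G] {E : Type} [Ring E] [Algebra ℂ E]

theorem eq_one_of_unit_mem_fixedSubalgebra [Finite G] [FiniteDimensional ℂ E] [IsSimpleRing E]
    {φ : G →* (E →ₐ[ℂ] E)} (hφ : IsPrimitiveAction φ) (hinj : Function.Injective φ)
    (S : Subgroup G) [S.Normal] {s : G} (hs : s ∈ S) {u : Eˣ}
    (hu : ∀ x, φ s x = u * x * ↑u⁻¹) (huS : (u : E) ∈ fixedSubalgebra φ S) : s = 1 := by
  let B : Subalgebra ℂ E := fixedSubalgebra φ S ⊓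
    Subalgebra.centralizer ℂ (fixedSubalgebra φ S : Set E)
  have hB : ∀ x ∈ B, ∀ y ∈ B, x * y = y * x := fun x hx y hy =>
    ((Subalgebra.mem_centralizer_iff ℂ).1 hy.2 x hx.1)
  have hBφ : ∀ g, ∀ x ∈ B, φ g x ∈ B := by
    refine fun g x hx => ⟨map_mem_fixedSubalgebra φ S g hx.1,
      (Subalgebra.mem_centralizer_iff ℂ).2 fun y hy => ?_⟩
    have h := (Subalgebra.mem_centralizer_iff ℂ).1 hx.2 _ (map_mem_fixedSubalgebra φ S g⁻¹ hy)
    have h2 := congrArg (φ g) h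
    rwa [map_mul, map_mul, map_apply_inv_self] at h2
  have huB : (u : E) ∈ B := by
    refine ⟨huS, (Subalgebra.mem_centralizer_iff ℂ).2 fun y hy => ?_⟩
    have h := hu y
    rw [hy s hs] at h
    have h2 : y * u = u * y * ↑u⁻¹ * u := congrArg (· * (u : E)) h
    rwa [mul_assoc, Units.inv_mul, mul_one] at h2
  have hpow : ∀ (n : ℕ) (x : E), φ (s ^ n) x = ↑(u ^ n) * x * ↑(u ^ n)⁻¹ := by
    intro n
    induction n with
    | zero => simp
    | succ n ih =>
      intro x
      rw [pow_succ, map_mul, AlgHom.mul_apply, hu, ih, pow_succ, mul_inv_rev]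
      simp only [Units.val_mul, mul_assoc]
  obtain ⟨c, hc⟩ := exists_eq_algebraMap_of_commute (x := (u : E) ^ orderOf s) fun y => by
    have h := hpow (orderOf s) y
    rw [pow_orderOf_eq_one, map_one, AlgHom.one_apply] at h
    have h2 := congrArg (· * ((u ^ orderOf s : Eˣ) : E)) h
    rw [← Units.val_pow_eq_pow_val]
    simpa only [mul_assoc, Units.inv_mul, mul_one] using h2.symm
  have hc0 : c ≠ 0 := by
    rintro rfl
    rw [map_zero] at hc
    exact (u ^ orderOf s).ne_zero (by simpa using hc)
  obtain ⟨w, hw⟩ := exists_eq_algebraMap_of_pow_eq hφ B hB hBφ huB (orderOf_pos s).ne' hc0 hc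
  refine hinj (AlgHom.ext fun x => ?_)
  rw [hu, map_one, AlgHom.one_apply, hw, Algebra.commutes, ← hw, mul_assoc, Units.mul_inv, mul_one]

theorem exists_map_unit_eq_smul [FiniteDimensional ℂ E] [IsSimpleRing E]
    {φ : G →* (E →ₐ[ℂ] E)} {s t : G} (hst : s * t = t * s) {u : Eˣ}
    (hu : ∀ x, φ t x = u * x * ↑u⁻¹) : ∃ c : ℂ, φ s u = c • (u : E) := by
  have key : ∀ y, φ s u * y = u * y * ↑u⁻¹ * φ s u := by
    intro y
    have h1 : φ s (φ t (φ s⁻¹ y)) = φ t y := by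
      rw [← AlgHom.mul_apply, ← map_mul, hst, map_mul, AlgHom.mul_apply, map_apply_inv_self]
    rw [← hu, ← h1, hu, map_mul, map_mul, map_apply_inv_self, mul_assoc, ← map_mul (φ s),
      Units.inv_mul, map_one, mul_one]
  obtain ⟨c, hc⟩ := exists_eq_algebraMap_of_commute (x := (↑u⁻¹ : E) * φ s u) fun y => by
    rw [mul_assoc, key, ← mul_assoc, ← mul_assoc, ← mul_assoc, Units.inv_mul, one_mul, mul_assoc]
  refine ⟨c, ?_⟩
  rw [Algebra.smul_def, Algebra.commutes, ← hc, ← mul_assoc, Units.mul_inv, one_mul]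

theorem exists_twist [Finite G] [FiniteDimensional ℂ E] [IsSimpleRing E]
    {φ : G →* (E →ₐ[ℂ] E)} (hφ : IsPrimitiveAction φ) (hinj : Function.Injective φ)
    {S : Subgroup G} [S.Normal] (hab : ∀ x ∈ S, ∀ y ∈ S, x * y = y * x)
    {s : G} (hs : s ∈ S) (hs1 : s ≠ 1) :
    ∃ t ∈ S, ∃ u : Eˣ, (∀ x, φ t x = u * x * ↑u⁻¹) ∧ ∃ c : ℂ, c ≠ 1 ∧ φ s u = c • (u : E) := by
  obtain ⟨v, hv⟩ := exists_unit_conj φ s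
  have h1 : (v : E) ∉ fixedSubalgebra φ S := fun h =>
    hs1 (eq_one_of_unit_mem_fixedSubalgebra hφ hinj S hs hv h)
  rw [mem_fixedSubalgebra] at h1
  push Not at h1
  obtain ⟨t, ht, hne⟩ := h1
  obtain ⟨u, hu⟩ := exists_unit_conj φ t
  obtain ⟨c, hc⟩ := exists_map_unit_eq_smul (φ := φ) (hab s hs t ht) hu
  refine ⟨t, ht, u, hu, c, ?_, hc⟩
  rintro rfl
  rw [one_smul, hv] at hc
  apply hne
  have h2 : (v : E) * u = u * v := by
    have := congrArg (· * (v : E)) hc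
    simpa [mul_assoc] using this
  rw [hu, ← h2, mul_assoc, Units.mul_inv, mul_one]

theorem trace_eq_zero_of_twist [FiniteDimensional ℂ E] (a : E →ₐ[ℂ] E) {u : Eˣ} {c : ℂ}
    (hc : c ≠ 1) (h : a u = c • (u : E)) : LinearMap.trace ℂ E a.toLinearMap = 0 := by
  have h1 : LinearMap.mulLeft ℂ (↑u⁻¹ : E) ∘ₗ (a.toLinearMap ∘ₗ LinearMap.mulLeft ℂ (u : E)) =
      c • a.toLinearMap := by
    ext x
    simp [h]
  have h2 := congrArg (LinearMap.trace ℂ E) h1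
  rw [LinearMap.trace_comp_comm', LinearMap.comp_assoc, ← LinearMap.mulLeft_mul, Units.mul_inv,
    LinearMap.mulLeft_one, LinearMap.comp_id, map_smul, smul_eq_mul] at h2
  by_contra h0
  exact hc (mul_right_cancel₀ h0 (by rw [← h2, one_mul]))

/-- The average of the translates of an element under a subgroup. -/
noncomputable def averageOver [Fintype G] (φ : G →* (E →ₐ[ℂ] E)) (S : Subgroup G) : E →ₗ[ℂ] E :=
  (Nat.card S : ℂ)⁻¹ • ∑ s : S, (φ s).toLinearMap

theorem averageOver_apply [Fintype G] (φ : G →* (E →ₐ[ℂ] E)) (S : Subgroup G) (x : E) :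
    averageOver φ S x = (Nat.card S : ℂ)⁻¹ • ∑ s : S, φ s x := by
  simp [averageOver]

theorem averageOver_mem [Fintype G] (φ : G →* (E →ₐ[ℂ] E)) (S : Subgroup G) (x : E) :
    averageOver φ S x ∈ fixedSubalgebra φ S := by
  intro t ht
  rw [averageOver_apply, map_smul, map_sum]
  congr 1
  refine Fintype.sum_equiv (Equiv.mulLeft (⟨t, ht⟩ : S)) _ _ fun s => ?_
  rw [← AlgHom.mul_apply, ← map_mul]
  rfl

theorem averageOver_mul [Fintype G] (φ : G →* (E →ₐ[ℂ] E)) (S : Subgroup G) (x : E) {y : E}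
    (hy : y ∈ fixedSubalgebra φ S) : averageOver φ S (x * y) = averageOver φ S x * y := by
  simp only [averageOver_apply, map_mul, smul_mul_assoc, Finset.sum_mul]
  congr 1
  exact Finset.sum_congr rfl fun s _ => by rw [hy s s.2]

theorem averageOver_one [Fintype G] (φ : G →* (E →ₐ[ℂ] E)) (S : Subgroup G) :
    averageOver φ S 1 = 1 := by
  simp only [averageOver_apply, map_one]
  rw [Finset.sum_const, Finset.card_univ, ← Nat.card_eq_fintype_card, ← Nat.cast_smul_eq_nsmul ℂ,
    smul_smul, inv_mul_cancel₀ (by simp), one_smul]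

theorem averageOver_of_mem [Fintype G] (φ : G →* (E →ₐ[ℂ] E)) (S : Subgroup G) {y : E}
    (hy : y ∈ fixedSubalgebra φ S) : averageOver φ S y = y := by
  have := averageOver_mul φ S 1 hy
  rwa [averageOver_one, one_mul] at this

theorem card_mul_finrank_fixedSubalgebra [Fintype G] [FiniteDimensional ℂ E] [IsSimpleRing E]
    {φ : G →* (E →ₐ[ℂ] E)} (hφ : IsPrimitiveAction φ) (hinj : Function.Injective φ)
    {S : Subgroup G} [S.Normal] (hab : ∀ x ∈ S, ∀ y ∈ S, x * y = y * x) :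
    Nat.card S * Module.finrank ℂ (fixedSubalgebra φ S) = Module.finrank ℂ E := by
  have hproj : LinearMap.IsProj (Subalgebra.toSubmodule (fixedSubalgebra φ S))
      (averageOver φ S) :=
    ⟨averageOver_mem φ S, fun x hx => averageOver_of_mem φ S hx⟩
  have h1 := hproj.trace
  have h2 : LinearMap.trace ℂ E (averageOver φ S) = (Nat.card S : ℂ)⁻¹ * Module.finrank ℂ E := by
    rw [averageOver, map_smul, map_sum, smul_eq_mul, Finset.sum_eq_single 1]
    · have : (φ ((1 : S) : G)).toLinearMap = LinearMap.id := by
        rw [Subgroup.coe_one, map_one]; rfl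
      rw [this, LinearMap.trace_id]
    · intro s _ hs
      obtain ⟨t, -, u, -, c, hc, hsu⟩ := exists_twist hφ hinj hab s.2
        (fun h => hs (Subtype.ext h))
      exact trace_eq_zero_of_twist _ hc hsu
    · simp
  rw [h2] at h1
  have h0 : (Nat.card S : ℂ) ≠ 0 := by simp
  have h3 : (Module.finrank ℂ E : ℂ) = Nat.card S * Module.finrank ℂ (fixedSubalgebra φ S) := by
    rw [inv_mul_eq_iff_eq_mul₀ h0] at h1
    exact h1
  exact_mod_cast h3.symm

theorem sum_unit_mul_map_inv_eq_zero [Fintype G] [FiniteDimensional ℂ E] [IsSimpleRing E]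
    {φ : G →* (E →ₐ[ℂ] E)} (hφ : IsPrimitiveAction φ) (hinj : Function.Injective φ)
    {S : Subgroup G} [S.Normal] (hab : ∀ x ∈ S, ∀ y ∈ S, x * y = y * x)
    {u : S → Eˣ} (hu : ∀ (t : S) x, φ t x = u t * x * ↑(u t)⁻¹) {s : G} (hs : s ∈ S)
    (hs1 : s ≠ 1) : ∑ t : S, (u t : E) * φ s ↑(u t)⁻¹ = 0 := by
  have hindep : ∀ (t : G) (v w : Eˣ), (∀ x, φ t x = v * x * ↑v⁻¹) → (∀ x, φ t x = w * x * ↑w⁻¹) →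
      (v : E) * φ s ↑v⁻¹ = w * φ s ↑w⁻¹ := by
    intro t v w hv hw
    obtain ⟨c, hc⟩ := exists_eq_algebraMap_of_commute (x := ((v⁻¹ * w : Eˣ) : E)) fun y => by
      have h := (hv y).symm.trans (hw y)
      have h2 := congrArg (fun z => (↑v⁻¹ : E) * z * w) h
      simp only [mul_assoc, Units.inv_mul, mul_one, Units.inv_mul_cancel_left] at h2
      rw [Units.val_mul, mul_assoc, ← h2]
    have hw' : w = v * (v⁻¹ * w) := by group
    have hz : φ s ↑(v⁻¹ * w)⁻¹ = ↑(v⁻¹ * w)⁻¹ := by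
      have h3 : φ s ↑(v⁻¹ * w) = ↑(v⁻¹ * w) := by rw [hc, AlgHom.commutes]
      calc φ s ↑(v⁻¹ * w)⁻¹ = ↑(v⁻¹ * w)⁻¹ * ↑(v⁻¹ * w) * φ s ↑(v⁻¹ * w)⁻¹ := by
            rw [Units.inv_mul, one_mul]
        _ = ↑(v⁻¹ * w)⁻¹ * φ s (↑(v⁻¹ * w) * ↑(v⁻¹ * w)⁻¹) := by
            rw [map_mul, h3, mul_assoc]
        _ = ↑(v⁻¹ * w)⁻¹ := by rw [Units.mul_inv, map_one, mul_one]
    conv_rhs => rw [hw']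
    rw [mul_inv_rev, Units.val_mul v, Units.val_mul (v⁻¹ * w)⁻¹, map_mul, hz, mul_assoc,
      Units.mul_inv_cancel_left]
  obtain ⟨t₀, ht₀, v, hv, c, hc, hsv⟩ := exists_twist hφ hinj hab hs hs1
  have hmul : ∀ t : S, (u (t * ⟨t₀, ht₀⟩) : E) * φ s ↑(u (t * ⟨t₀, ht₀⟩))⁻¹ =
      (u t : E) * (v * φ s ↑v⁻¹) * φ s ↑(u t)⁻¹ := by
    intro t
    rw [hindep (t * t₀) (u (t * ⟨t₀, ht₀⟩)) (u t * v)
      (hu (t * ⟨t₀, ht₀⟩)) fun x => by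
      rw [map_mul, AlgHom.mul_apply, hv, hu]
      simp only [mul_inv_rev, Units.val_mul, mul_assoc]]
    simp only [mul_inv_rev, Units.val_mul, mul_assoc, map_mul]
  have hv' : c • ((v : E) * φ s ↑v⁻¹) = 1 := by
    rw [← smul_mul_assoc, ← hsv, ← map_mul, Units.mul_inv, map_one]
  set A := ∑ t : S, (u t : E) * φ s ↑(u t)⁻¹ with hA
  have h1 : c • A = A := by
    calc c • A = ∑ t : S, c • ((u (t * ⟨t₀, ht₀⟩) : E) * φ s ↑(u (t * ⟨t₀, ht₀⟩))⁻¹) := by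
          rw [hA, Finset.smul_sum]
          exact (Equiv.sum_comp (Equiv.mulRight (⟨t₀, ht₀⟩ : S)) fun t =>
            c • ((u t : E) * φ s ↑(u t)⁻¹)).symm
      _ = A := by
          refine Finset.sum_congr rfl fun t _ => ?_
          rw [hmul, ← smul_mul_assoc, ← mul_smul_comm, hv', mul_one]
  have h2 : (c - 1) • A = 0 := by rw [sub_smul, one_smul, h1, sub_self]
  exact (smul_eq_zero.1 h2).resolve_left (sub_ne_zero.2 hc)

theorem sum_unit_mul_averageOver [Fintype G] [FiniteDimensional ℂ E] [IsSimpleRing E]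
    {φ : G →* (E →ₐ[ℂ] E)} (hφ : IsPrimitiveAction φ) (hinj : Function.Injective φ)
    {S : Subgroup G} [S.Normal] (hab : ∀ x ∈ S, ∀ y ∈ S, x * y = y * x)
    {u : S → Eˣ} (hu : ∀ (t : S) x, φ t x = u t * x * ↑(u t)⁻¹) (x : E) :
    ∑ t : S, (u t : E) * averageOver φ S (↑(u t)⁻¹ * x) = x := by
  have h0 : (Nat.card S : ℂ) ≠ 0 := by simp
  calc ∑ t : S, (u t : E) * averageOver φ S (↑(u t)⁻¹ * x)
      = (Nat.card S : ℂ)⁻¹ • ∑ t : S, ∑ s : S, (u t : E) * φ s ↑(u t)⁻¹ * φ s x := by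
        rw [Finset.smul_sum]
        refine Finset.sum_congr rfl fun t _ => ?_
        rw [averageOver_apply, mul_smul_comm, Finset.mul_sum]
        congr 1
        exact Finset.sum_congr rfl fun s _ => by rw [map_mul, mul_assoc]
    _ = (Nat.card S : ℂ)⁻¹ • ∑ s : S, (∑ t : S, (u t : E) * φ s ↑(u t)⁻¹) * φ s x := by
        rw [Finset.sum_comm]
        simp only [Finset.sum_mul]
    _ = (Nat.card S : ℂ)⁻¹ • ((Nat.card S : ℂ) • x) := by
        rw [Finset.sum_eq_single 1]
        · simp [Nat.cast_smul_eq_nsmul, ← Nat.card_eq_fintype_card, ← nsmul_eq_mul]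
        · intro s _ hs
          rw [sum_unit_mul_map_inv_eq_zero hφ hinj hab hu s.2 (fun h => hs (Subtype.ext h)),
            zero_mul]
        · simp
    _ = x := by rw [smul_smul, inv_mul_cancel₀ h0, one_smul]

theorem isSimpleRing_fixedSubalgebra [Fintype G] [FiniteDimensional ℂ E] [IsSimpleRing E]
    {φ : G →* (E →ₐ[ℂ] E)} (hφ : IsPrimitiveAction φ) (hinj : Function.Injective φ)
    {S : Subgroup G} [S.Normal] (hab : ∀ x ∈ S, ∀ y ∈ S, x * y = y * x) :
    IsSimpleRing (fixedSubalgebra φ S) := by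
  choose u hu using fun t : S => exists_unit_conj φ (t : G)
  have hdec := sum_unit_mul_averageOver hφ hinj hab hu
  refine isSimpleRing_iff_isTwoSided_imp.2 ⟨inferInstance, fun I hI =>
    or_iff_not_imp_left.2 fun hI0 => ?_⟩
  obtain ⟨x, hxI, hx0⟩ := Submodule.exists_mem_ne_zero_of_ne_bot hI0
  let π : E →ₗ[ℂ] fixedSubalgebra φ S :=
    LinearMap.codRestrict (Subalgebra.toSubmodule (fixedSubalgebra φ S)) (averageOver φ S)
      (averageOver_mem φ S)
  have hπ : ∀ y, (π y : E) = averageOver φ S y := fun _ => rfl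
  let J : Ideal E :=
    { carrier := {y | ∀ a b, π (a * y * b) ∈ I}
      zero_mem' := fun a b => by simp
      add_mem' := fun {y z} hy hz a b => by
        rw [mul_add, add_mul, map_add]
        exact I.add_mem (hy a b) (hz a b)
      smul_mem' := fun c y hy a b => by
        rw [smul_eq_mul, ← mul_assoc]
        exact hy (a * c) b }
  have hJ : J.IsTwoSided := ⟨fun {y} c hy a b => by
    have := hy a (c * b)
    rwa [← mul_assoc, mul_assoc a] at this⟩
  have hxJ : (x : E) ∈ J := by
    intro a b
    rw [← hdec a, ← hdec b, Finset.sum_mul, Finset.sum_mul, map_sum]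
    refine I.sum_mem fun s _ => ?_
    rw [Finset.mul_sum, map_sum]
    refine I.sum_mem fun t _ => ?_
    set a' := π (↑(u s)⁻¹ * a) with ha'
    set b' := π (↑(u t)⁻¹ * b) with hb'
    have hcomm : ((a' * x : fixedSubalgebra φ S) : E) * u t =
        u t * ((a' * x : fixedSubalgebra φ S) : E) := by
      have h := hu t (a' * x : fixedSubalgebra φ S)
      rw [(a' * x).2 t t.2] at h
      have h2 := congrArg (· * (u t : E)) h
      simpa only [mul_assoc, Units.inv_mul, mul_one] using h2
    have h : π ((u s : E) * averageOver φ S (↑(u s)⁻¹ * a) * x *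
        (u t * averageOver φ S (↑(u t)⁻¹ * b))) = π (u s * u t) * a' * x * b' := by
      apply Subtype.ext
      have : (u s : E) * averageOver φ S (↑(u s)⁻¹ * a) * x *
          (u t * averageOver φ S (↑(u t)⁻¹ * b)) =
          u s * u t * ((a' * x * b' : fixedSubalgebra φ S) : E) := by
        calc (u s : E) * averageOver φ S (↑(u s)⁻¹ * a) * x *
            (u t * averageOver φ S (↑(u t)⁻¹ * b))
            = u s * (((a' * x : fixedSubalgebra φ S) : E) * u t) * b' := by
              rw [ha', hb']
              simp only [Subalgebra.coe_mul, hπ, mul_assoc]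
          _ = _ := by
              rw [hcomm]
              simp only [Subalgebra.coe_mul, mul_assoc]
      rw [this, hπ, averageOver_mul φ S _ (a' * x * b').2]
      simp only [Subalgebra.coe_mul, hπ, mul_assoc]
    rw [h]
    exact I.mul_mem_right _ (I.mul_mem_left _ hxI)
  have hJtop : J = ⊤ := by
    refine ((isSimpleRing_iff_isTwoSided_imp.1 ‹IsSimpleRing E›).2 J hJ).resolve_left ?_
    intro h
    rw [h] at hxJ
    exact hx0 (Subtype.ext (by simpa using hxJ))
  have h1 : (1 : E) ∈ J := hJtop ▸ Submodule.mem_top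
  have h2 := h1 1 1
  rw [Ideal.eq_top_iff_one]
  convert h2
  apply Subtype.ext
  rw [hπ, mul_one, mul_one, averageOver_one]
  rfl

end Twist

section Induction

variable {G : Type*} [Group G] {E : Type} [Ring E] [Algebra ℂ E]

/-- The action of `G ⧸ S` on the `S`-fixed elements. -/
noncomputable def quotientAction (φ : G →* (E →ₐ[ℂ] E)) (S : Subgroup G) [S.Normal] :
    G ⧸ S →* (fixedSubalgebra φ S →ₐ[ℂ] fixedSubalgebra φ S) :=
  QuotientGroup.lift S
    { toFun := fun g => ((φ g).comp (fixedSubalgebra φ S).val).codRestrict _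
        fun x => map_mem_fixedSubalgebra φ S g x.2
      map_one' := by
        ext x
        simp
      map_mul' := fun g h => by
        ext x
        exact DFunLike.congr_fun (map_mul φ g h) (x : E) }
    fun s hs => by
      ext x
      exact x.2 s hs

theorem isPrimitiveAction_quotientAction {φ : G →* (E →ₐ[ℂ] E)} (hφ : IsPrimitiveAction φ)
    (S : Subgroup G) [S.Normal] : IsPrimitiveAction (quotientAction φ S) := by
  intro e he h
  refine (hφ e (by exact_mod_cast congrArg Subtype.val he) fun g => ?_).imp
    (fun h0 => Subtype.ext h0) (fun h1 => Subtype.ext h1)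
  exact (h g).imp (fun h0 => congrArg Subtype.val h0) (fun h1 => congrArg Subtype.val h1)

theorem isPrimitiveAction_kerLift {φ : G →* (E →ₐ[ℂ] E)} (hφ : IsPrimitiveAction φ) :
    IsPrimitiveAction (QuotientGroup.lift φ.ker φ fun _ h => h) :=
  fun e he h => hφ e he fun g => h g

theorem finrank_eq_one_of_isPrimitiveAction [Subsingleton G] [FiniteDimensional ℂ E]
    [IsSimpleRing E] {φ : G →* (E →ₐ[ℂ] E)} (hφ : IsPrimitiveAction φ) :
    Module.finrank ℂ E = 1 := by
  obtain ⟨n, hn, ⟨f⟩⟩ := IsSimpleRing.exists_algEquiv_matrix_of_isAlgClosed ℂ E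
  let e : Matrix (Fin n) (Fin n) ℂ := Matrix.single 0 0 1
  have h := hφ (f.symm e) (by rw [← map_mul]; congr 1; simp [e]) fun g => by
    left
    rw [Subsingleton.elim g 1, map_one, AlgHom.one_apply]
  simp only [EmbeddingLike.map_eq_zero_iff, EmbeddingLike.map_eq_one_iff] at h
  have h1 : e = 1 := h.resolve_left fun h0 => by
    have := congrFun (congrFun h0 0) 0
    simp [e] at this
  have hsub : ∀ j : Fin n, j = 0 := by
    intro j
    by_contra hj
    have := congrFun (congrFun h1 j) j
    simp [e, Matrix.single_apply_of_row_ne (Ne.symm hj)] at this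
  have hcard : Fintype.card (Fin n) = 1 := Fintype.card_eq_one_iff.2 ⟨0, hsub⟩
  rw [f.toLinearEquiv.finrank_eq, Module.finrank_matrix, hcard, Module.finrank_self]

theorem sum_comp_quotient_mk [Fintype G] (N : Subgroup G) [Fintype (G ⧸ N)] (F : G ⧸ N → ℕ) :
    ∑ g : G, F g = Nat.card N * ∑ q, F q := by
  rw [← Finset.sum_fiberwise (s := Finset.univ) (g := fun g : G => (g : G ⧸ N)), Finset.mul_sum]
  refine Finset.sum_congr rfl fun q _ => ?_
  rw [Finset.sum_congr rfl fun g hg => by rw [(Finset.mem_filter.1 hg).2], Finset.sum_const,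
    smul_eq_mul]
  congr 1
  rw [← mul_one (Nat.card N), ← Set.ncard_singleton q, ← Nat.card_coe_set_eq {q},
    ← QuotientGroup.card_preimage_mk N {q}, Nat.card_coe_set_eq, ← Set.ncard_coe_finset]
  congr 1
  ext g
  simp

theorem card_mul_sum_factorization_quotient_add_le [Fintype G] (p : ℕ) (N : Subgroup G)
    [N.Normal] [Fintype (G ⧸ N)] :
    Nat.card N * (∑ q : G ⧸ N, (Subgroup.centralizer {q}).index.factorization p) +
      ∑ g : G, ((Subgroup.centralizer {g}).relIndex N).factorization p ≤
      ∑ g : G, (Subgroup.centralizer {g}).index.factorization p := by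
  rw [← sum_comp_quotient_mk, ← Finset.sum_add_distrib]
  refine Finset.sum_le_sum fun g _ => ?_
  have h := relIndex_mul_index_centralizer_dvd N g
  have h1 : (Subgroup.centralizer {g}).index ≠ 0 := Subgroup.index_ne_zero_of_finite
  have h2 : (Subgroup.centralizer {g}).relIndex N ≠ 0 := fun h0 => h1 (by
    rw [h0, zero_mul] at h
    exact zero_dvd_iff.1 h)
  have h3 : (Subgroup.centralizer {(g : G ⧸ N)}).index ≠ 0 := Subgroup.index_ne_zero_of_finite
  have h4 := (Nat.factorization_le_iff_dvd (mul_ne_zero h2 h3) h1).2 h p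
  rw [Nat.factorization_mul h2 h3, Finsupp.add_apply] at h4
  rwa [add_comm]

theorem exists_minimal_normal (G : Type*) [Group G] [Finite G] [Nontrivial G] :
    ∃ S : Subgroup G, S.Normal ∧ S ≠ ⊥ ∧ ∀ T : Subgroup G, T.Normal → T ≤ S → T = ⊥ ∨ T = S := by
  obtain ⟨S, ⟨hS, hS0⟩, hmin⟩ := (Set.toFinite {T : Subgroup G | T.Normal ∧ T ≠ ⊥}).exists_minimal
    ⟨⊤, inferInstance, bot_ne_top.symm⟩
  exact ⟨S, hS, hS0, fun T hT hTS => or_iff_not_imp_left.2 fun h =>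
    le_antisymm hTS (hmin ⟨hT, h⟩ hTS)⟩

theorem not_le_center_of_minimal_normal [Finite G] [FiniteDimensional ℂ E] [IsSimpleRing E]
    {φ : G →* (E →ₐ[ℂ] E)} (hφ : IsPrimitiveAction φ) (hinj : Function.Injective φ)
    {S : Subgroup G} [S.Normal] (hS0 : S ≠ ⊥)
    (hmin : ∀ T : Subgroup G, T.Normal → T ≤ S → T = ⊥ ∨ T = S) :
    ¬ S ≤ Subgroup.center G := by
  intro hS
  obtain ⟨⟨t, ht⟩, ht1⟩ := Subgroup.ne_bot_iff_exists_ne_one.1 hS0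
  replace ht1 : t ≠ 1 := fun h => ht1 (Subtype.ext h)
  have hle : Subgroup.zpowers t ≤ S := Subgroup.zpowers_le.2 ht
  have hnormal : (Subgroup.zpowers t).Normal := ⟨fun n hn g => by
    rwa [Subgroup.mem_center_iff.1 (hS (hle hn)) g, mul_inv_cancel_right]⟩
  have hzS : Subgroup.zpowers t = S := (hmin _ hnormal hle).resolve_left
    fun h => ht1 (Subgroup.zpowers_eq_bot.1 h)
  obtain ⟨u, hu⟩ := exists_unit_conj φ t
  refine ht1 (eq_one_of_unit_mem_fixedSubalgebra hφ hinj S ht hu fun s hs => ?_)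
  rw [← hzS, ← mem_powers_iff_mem_zpowers] at hs
  obtain ⟨m, rfl⟩ := hs
  induction m with
  | zero => simp
  | succ m ih =>
    have h : φ t u = u := by rw [hu, mul_assoc, Units.mul_inv, mul_one]
    simp only [pow_succ, map_mul, AlgHom.mul_apply, h] at ih ⊢
    exact ih

theorem card_mul_factorization_finrank_le (p : ℕ) {G : Type*} [Group G] [Fintype G]
    [Group.IsSolvable G] {E : Type} [Ring E] [Algebra ℂ E] [FiniteDimensional ℂ E]
    [IsSimpleRing E] {φ : G →* (E →ₐ[ℂ] E)} (hφ : IsPrimitiveAction φ) :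
    Nat.card G * (Module.finrank ℂ E).factorization p ≤
      4 * ∑ g : G, (Subgroup.centralizer {g}).index.factorization p := by
  induction hn : Nat.card G using Nat.strong_induction_on generalizing G E with
  | _ n ih =>
  subst hn
  have hlt : ∀ (N : Subgroup G), N ≠ ⊥ → Nat.card (G ⧸ N) < Nat.card G := by
    intro N hN
    rw [Subgroup.card_eq_card_quotient_mul_card_subgroup N]
    exact lt_mul_of_one_lt_right Nat.card_pos ((Subgroup.one_lt_card_iff_ne_bot N).2 hN)
  by_cases hinj : Function.Injective φ
  · rcases subsingleton_or_nontrivial G with hG | hG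
    · rw [finrank_eq_one_of_isPrimitiveAction hφ]
      simp
    obtain ⟨S, hSn, hS0, hmin⟩ := exists_minimal_normal G
    have hab : ∀ x ∈ S, ∀ y ∈ S, x * y = y * x := by
      have hlt := Group.IsSolvable.commutator_lt_of_ne_bot hS0
      have h := (hmin ⁅S, S⁆ inferInstance hlt.le).resolve_right hlt.ne
      rw [Subgroup.commutator_eq_bot_iff_le_centralizer] at h
      exact fun x hx y hy => (Subgroup.mem_centralizer_iff.1 (h hx) y hy).symm
    have hSc := not_le_center_of_minimal_normal hφ hinj hS0 hmin
    have := isSimpleRing_fixedSubalgebra hφ hinj hab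
    have hfin := card_mul_finrank_fixedSubalgebra hφ hinj hab
    have h1 := ih _ (hlt S hS0) (isPrimitiveAction_quotientAction hφ S) rfl
    have h2 := card_mul_sum_factorization_quotient_add_le p S
    have h3 := sum_factorization_card_inf_centralizer_le p S hab hmin hSc
    have h4 : ∑ g : G, (Nat.card ↥(S ⊓ Subgroup.centralizer {g})).factorization p +
        ∑ g : G, ((Subgroup.centralizer {g}).relIndex S).factorization p =
        Nat.card G * (Nat.card S).factorization p := by
      rw [← Finset.sum_add_distrib, Nat.card_eq_fintype_card, ← Finset.card_univ, ← smul_eq_mul,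
        ← Finset.sum_const]
      refine Finset.sum_congr rfl fun g _ => ?_
      have h := card_mul_relIndex_of_le (inf_le_left : S ⊓ Subgroup.centralizer {g} ≤ S)
      rw [Subgroup.inf_relIndex_left] at h
      have h0 : (Subgroup.centralizer {g}).relIndex S ≠ 0 := fun h0 => by
        rw [h0, mul_zero] at h
        exact Nat.card_pos.ne h
      rw [← h, Nat.factorization_mul Nat.card_pos.ne' h0, Finsupp.add_apply]
    have h5 : (Module.finrank ℂ E).factorization p = (Nat.card S).factorization p +
        (Module.finrank ℂ (fixedSubalgebra φ S)).factorization p := by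
      rw [← hfin, Nat.factorization_mul Nat.card_pos.ne' Module.finrank_pos.ne', Finsupp.add_apply]
    have h6 := Subgroup.card_eq_card_quotient_mul_card_subgroup S
    have h7 := Nat.mul_le_mul_left (Nat.card S) h1
    have h8 : Nat.card G * (Module.finrank ℂ (fixedSubalgebra φ S)).factorization p =
        Nat.card S * (Nat.card (G ⧸ S) *
          (Module.finrank ℂ (fixedSubalgebra φ S)).factorization p) := by
      rw [h6]; ring
    rw [h5, mul_add, h8]
    linarith
  · have hK : φ.ker ≠ ⊥ := fun h => hinj ((MonoidHom.ker_eq_bot_iff φ).1 h)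
    have h1 := ih _ (hlt _ hK) (isPrimitiveAction_kerLift hφ) rfl
    have h2 := card_mul_sum_factorization_quotient_add_le p φ.ker
    have h6 := Subgroup.card_eq_card_quotient_mul_card_subgroup φ.ker
    have h7 := Nat.mul_le_mul_left (Nat.card φ.ker) h1
    have h8 := (Nat.le_add_right _ _).trans h2
    calc Nat.card G * (Module.finrank ℂ E).factorization p
        = Nat.card φ.ker * (Nat.card (G ⧸ φ.ker) * (Module.finrank ℂ E).factorization p) := by
          rw [h6]; ring
      _ ≤ _ := h7
      _ = 4 * (Nat.card φ.ker *
          ∑ q : G ⧸ φ.ker, (Subgroup.centralizer {q}).index.factorization p) := by ring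
      _ ≤ _ := Nat.mul_le_mul_left 4 h8

end Induction

section Characters

variable {G : Type*} [Group G] {V : Type} [AddCommGroup V] [Module ℂ V]

/-- The conjugation action of `G` on the endomorphism algebra of a representation. -/
def conjAction (ρ : Representation ℂ G V) : G →* (Module.End ℂ V →ₐ[ℂ] Module.End ℂ V) where
  toFun g := AlgHom.ofLinearMap (LinearMap.mulLeftRight ℂ (ρ g, ρ g⁻¹))
    (by simp [← map_mul])
    (fun x y => by
      simp only [LinearMap.mulLeftRight_apply]
      rw [show ρ g * x * ρ g⁻¹ * (ρ g * y * ρ g⁻¹) = ρ g * x * (ρ g⁻¹ * ρ g) * y * ρ g⁻¹ by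
        simp only [mul_assoc], ← map_mul, inv_mul_cancel, map_one, mul_one]
      simp only [mul_assoc])
  map_one' := by
    ext1 x
    simp
  map_mul' g h := by
    ext1 x
    simp [mul_assoc]

theorem conjAction_apply (ρ : Representation ℂ G V) (g : G) (x : Module.End ℂ V) :
    conjAction ρ g x = ρ g * x * ρ g⁻¹ := by
  simp [conjAction]

theorem rep_inv_mul (ρ : Representation ℂ G V) (g : G) : ρ g⁻¹ * ρ g = 1 := by
  rw [← map_mul, inv_mul_cancel, map_one]

theorem exists_eq_smul_one_of_commute [FiniteDimensional ℂ V] [Nontrivial V]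
    (ρ : Representation ℂ G V)
    (hirr : ∀ U : Submodule ℂ V, (∀ g : G, ∀ v ∈ U, ρ g v ∈ U) → U = ⊥ ∨ U = ⊤)
    {T : Module.End ℂ V} (hT : ∀ g, ρ g * T = T * ρ g) : ∃ c : ℂ, T = c • 1 := by
  obtain ⟨c, hc⟩ := Module.End.exists_eigenvalue T
  refine ⟨c, ?_⟩
  have h := (hirr (Module.End.eigenspace T c) fun g v hv => by
    rw [Module.End.mem_eigenspace_iff] at hv ⊢
    rw [← Module.End.mul_apply, ← hT, Module.End.mul_apply, hv, map_smul]).resolve_left hc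
  ext v
  have hv : v ∈ Module.End.eigenspace T c := h ▸ Submodule.mem_top
  rw [Module.End.mem_eigenspace_iff] at hv
  simp [hv]

theorem isChar_trace_mul_idempotent [FiniteDimensional ℂ V] (ρ : Representation ℂ G V)
    (H : Subgroup G) {e : Module.End ℂ V} (he : e * e = e) (hH : ∀ h ∈ H, ρ h * e = e * ρ h) :
    IsChar fun h : H => LinearMap.trace ℂ V (ρ h * e) := by
  have hmem : ∀ h : H, ∀ v ∈ LinearMap.range e, ρ h v ∈ LinearMap.range e := by
    rintro h _ ⟨v, rfl⟩
    exact ⟨ρ h v, (DFunLike.congr_fun (hH h h.2) v).symm⟩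
  let σ : Representation ℂ H (LinearMap.range e) :=
    { toFun := fun h => (ρ h).restrict (hmem h)
      map_one' := by
        ext v
        simp
      map_mul' := fun g h => by
        ext v
        simp }
  refine ⟨LinearMap.range e, inferInstance, inferInstance, inferInstance, σ, fun h => ?_⟩
  have hall : ∀ v, (ρ h * e) v ∈ LinearMap.range e := fun v => hmem h _ ⟨v, rfl⟩
  beta_reduce
  rw [← LinearMap.trace_restrict_eq_of_forall_mem _ _ hall]
  congr 1
  ext ⟨_, v, rfl⟩
  exact congrArg (ρ h) (DFunLike.congr_fun he v)

theorem isPrimitiveAction_conjAction [Fintype G] [FiniteDimensional ℂ V] [Nontrivial V]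
    (ρ : Representation ℂ G V)
    (hirr : ∀ U : Submodule ℂ V, (∀ g : G, ∀ v ∈ U, ρ g v ∈ U) → U = ⊥ ∨ U = ⊤)
    (hprim : ∀ H : Subgroup G, H ≠ ⊤ → ∀ ψ : H → ℂ, IsChar ψ →
      (fun g => LinearMap.trace ℂ V (ρ g)) ≠ inducedChar H ψ) :
    IsPrimitiveAction (conjAction ρ) := by
  intro e he horb
  refine or_iff_not_imp_left.2 fun he0 => ?_
  let H : Subgroup G :=
    { carrier := {g | conjAction ρ g e = e}
      one_mem' := by simp
      mul_mem' := fun {a b} ha hb => by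
        simp only [Set.mem_ofPred_eq] at ha hb ⊢
        rw [map_mul, AlgHom.mul_apply, hb, ha]
      inv_mem' := fun {a} ha => by
        simp only [Set.mem_ofPred_eq] at ha ⊢
        conv_lhs => rw [← ha]
        exact map_inv_apply_self _ a e }
  have hmemH : ∀ g, g ∈ H ↔ conjAction ρ g e = e := fun g => Iff.rfl
  have hHcomm : ∀ h ∈ H, ρ h * e = e * ρ h := by
    intro h hh
    rw [hmemH, conjAction_apply] at hh
    conv_rhs => rw [← hh]
    rw [mul_assoc, rep_inv_mul, mul_one]
  set T := ∑ x, conjAction ρ x e with hT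
  have hTfix : ∀ g, conjAction ρ g T = T := by
    intro g
    rw [hT, map_sum]
    refine Fintype.sum_equiv (Equiv.mulLeft g) _ _ fun x => ?_
    rw [Equiv.coe_mulLeft, map_mul, AlgHom.mul_apply]
  obtain ⟨c, hc⟩ := exists_eq_smul_one_of_commute ρ hirr (T := T) fun g => by
    conv_rhs => rw [← hTfix g, conjAction_apply]
    rw [mul_assoc, rep_inv_mul, mul_one]
  have heT : e * T = (Nat.card H : ℂ) • e := by
    rw [hT, Finset.mul_sum]
    calc ∑ x, e * conjAction ρ x e = ∑ x, if x ∈ H then e else 0 := by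
          refine Finset.sum_congr rfl fun x _ => ?_
          split_ifs with hx
          · rw [(hmemH x).1 hx, he]
          · exact (horb x).resolve_left hx
      _ = (Nat.card H : ℂ) • e := by
          rw [← Finset.sum_filter, Finset.sum_const, Nat.cast_smul_eq_nsmul]
          congr 1
          rw [← Set.ncard_coe_finset, ← Nat.card_coe_set_eq]
          simp
  have hcH : c = Nat.card H := by
    rw [hc, mul_smul_comm, mul_one] at heT
    exact smul_left_injective ℂ he0 heT
  have hH0 : (Nat.card H : ℂ) ≠ 0 := by simp
  have htop : H = ⊤ := by
    by_contra hne
    refine hprim H hne _ (isChar_trace_mul_idempotent ρ H he hHcomm) ?_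
    funext g
    rw [inducedChar, eq_inv_mul_iff_mul_eq₀ hH0]
    have h1 : (Nat.card H : ℂ) * LinearMap.trace ℂ V (ρ g) = LinearMap.trace ℂ V (ρ g * T) := by
      rw [hc, hcH, mul_smul_comm, mul_one, map_smul, smul_eq_mul]
    rw [h1, hT, Finset.mul_sum, map_sum]
    refine Finset.sum_congr rfl fun x _ => ?_
    have h2 : LinearMap.trace ℂ V (ρ g * conjAction ρ x e) =
        LinearMap.trace ℂ V (ρ (x⁻¹ * g * x) * e) := by
      rw [conjAction_apply, ← mul_assoc, LinearMap.trace_mul_comm, map_mul ρ, map_mul ρ]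
      simp only [mul_assoc]
    rw [h2]
    split_ifs with hx
    · rfl
    · have h3 := (horb _).resolve_left hx
      rw [conjAction_apply] at h3
      have h4 : e * ρ (x⁻¹ * g * x) * e = 0 := by
        have := congrArg (· * ρ (x⁻¹ * g * x)) h3
        simpa only [mul_assoc, rep_inv_mul, mul_one, zero_mul] using this
      rw [← he, ← mul_assoc, LinearMap.trace_mul_comm, ← mul_assoc, h4, map_zero]
  have h5 : (Nat.card H : ℂ) • e = (Nat.card H : ℂ) • (1 : Module.End ℂ V) := by
    rw [← hcH, ← hc, hcH, hT,
      Finset.sum_congr rfl fun x _ => (hmemH x).1 (htop ▸ Subgroup.mem_top x), Finset.sum_const,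
      Finset.card_univ, htop, Subgroup.card_top, Nat.card_eq_fintype_card, Nat.cast_smul_eq_nsmul]
  exact smul_right_injective _ hH0 h5

theorem classSize_eq_index_centralizer (g : G) :
    classSize g = (Subgroup.centralizer {g}).index := by
  refine (Nat.card_congr (Equiv.ofBijective
    (Quotient.lift (fun x => (⟨x * g * x⁻¹, isConj_iff.2 ⟨x, rfl⟩⟩ : {y : G // IsConj g y}))
      ?_ : G ⧸ Subgroup.centralizer {g} → _) ⟨?_, ?_⟩)).symm
  · intro a b hab
    rw [← Quotient.eq_iff_equiv] at hab
    have h := Subgroup.mem_centralizer_singleton_iff.1 (QuotientGroup.eq.1 hab)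
    apply Subtype.ext
    have h2 := congrArg (fun z => a * z * b⁻¹) h
    simpa [mul_assoc] using h2.symm
  · rintro ⟨a⟩ ⟨b⟩ hab
    refine QuotientGroup.eq.2 (Subgroup.mem_centralizer_singleton_iff.2 ?_)
    have h : a * g * a⁻¹ = b * g * b⁻¹ := congrArg Subtype.val hab
    have h2 := congrArg (fun z => a⁻¹ * z * b) h
    simpa [mul_assoc] using h2.symm
  · rintro ⟨y, hy⟩
    obtain ⟨x, rfl⟩ := isConj_iff.1 hy
    exact ⟨(x : G ⧸ Subgroup.centralizer {g}), rfl⟩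

end Characters

theorem primitive_char_pPart_dvd_cube_of_class_size {G : Type*} [Group G] [Fintype G]
    (hsolv : IsSolvable G)
    (χ : G → ℂ) (hχ : IsPrimitiveChar χ)
    (d : ℕ) (hd : χ 1 = (d : ℂ))
    (p : ℕ) (hp : p.Prime) (hpG : p ∣ Fintype.card G) :
    ∃ g : G, pPart p d ∣ (pPart p (classSize g)) ^ 3 := by
  obtain ⟨⟨V, _, _, _, ρ, hV, hirr, hχρ⟩, hprim⟩ := hχ
  obtain rfl : χ = fun g => LinearMap.trace ℂ V (ρ g) := funext hχρ
  have hd' : Module.finrank ℂ V = d := by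
    have h : LinearMap.trace ℂ V (ρ 1) = d := hd
    rw [map_one, LinearMap.trace_one] at h
    exact_mod_cast h
  have hs : Group.IsSolvable G := hsolv
  have hφ := isPrimitiveAction_conjAction ρ hirr hprim
  have : IsSimpleRing (Module.End ℂ V) := by
    have : Nonempty (Fin (Module.finrank ℂ V)) := ⟨⟨0, Module.finrank_pos⟩⟩
    exact IsSimpleRing.of_ringEquiv
      (algEquivMatrix (Module.finBasis ℂ V)).symm.toRingEquiv inferInstance
  have hle := card_mul_factorization_finrank_le p hφ
  obtain ⟨g, -, hg⟩ := Finset.exists_max_image Finset.univ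
    (fun g : G => (Subgroup.centralizer {g}).index.factorization p) ⟨1, Finset.mem_univ _⟩
  refine ⟨g, ?_⟩
  have hsum := Finset.sum_le_card_nsmul Finset.univ _ _ hg
  rw [Finset.card_univ, ← Nat.card_eq_fintype_card, smul_eq_mul] at hsum
  have hd0 : d ≠ 0 := hd' ▸ Module.finrank_pos.ne'
  rw [Module.finrank_linearMap, hd', Nat.factorization_mul hd0 hd0, Finsupp.add_apply] at hle
  have h2 : d.factorization p ≤ (Subgroup.centralizer {g}).index.factorization p * 3 := by
    have : Nat.card G * (d.factorization p + d.factorization p) ≤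
        Nat.card G * (4 * (Subgroup.centralizer {g}).index.factorization p) := by
      linarith
    have := Nat.le_of_mul_le_mul_left this Nat.card_pos
    omega
  rw [pPart, pPart, classSize_eq_index_centralizer, ← pow_mul]
  exact pow_dvd_pow p h2
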